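/- Let A be a residually solvable group, C a subgroup of A, and φ : A → A a group automorphism. Let G = A ∗_{C = φ(C)} A be the double of A over C via φ. Then G is meta-residually-solvable: there exists a normal subgroup N of G such that both N and G/N are residually solvable. -/

import Mathlib

open scoped Pointwise

/-- The two maps `C →* A` defining the double `D = A ∗_{C = φ(C)} A`: the first copy of `A`
receives `C` by inclusion, the second copy receives `C` via `φ` followed by inclusion. -/
def doubleMaps {A : Type*} [Group A] (C : Subgroup A) (φ : A ≃* A) :
    Bool → (↥C →* A) :=
  fun b => match b with
  | false => C.subtype
  | true => (φ : A →* A).comp C.subtype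

/-- The double `A ∗_{C = φ(C)} A`: the amalgamated free product (pushout) of two copies of `A`
over `C`, amalgamating `C` in the first copy with `φ(C)` in the second copy via `φ`. -/
abbrev Double {A : Type*} [Group A] (C : Subgroup A) (φ : A ≃* A) : Type _ :=
  Monoid.PushoutI (doubleMaps C φ)

/-- The canonical embedding of the first copy of `A` into the double. -/
def Double.inl {A : Type*} [Group A] (C : Subgroup A) (φ : A ≃* A) : A →* Double C φ :=
  Monoid.PushoutI.of (φ := doubleMaps C φ) false

/-- The canonical embedding of the second copy of `A` into the double. -/
def Double.inr {A : Type*} [Group A] (C : Subgroup A) (φ : A ≃* A) : A →* Double C φ :=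
  Monoid.PushoutI.of (φ := doubleMaps C φ) true

/-- A group is residually solvable if every nontrivial element survives in some solvable
homomorphic image. -/
def ResiduallySolvable (G : Type u) [Group G] : Prop :=
  ∀ g : G, g ≠ 1 → ∃ (S : Type u) (_ : Group S) (f : G →* S), IsSolvable S ∧ f g ≠ 1

section ResidualSolvability

theorem ResiduallySolvable.of_injective {G H : Type u} [Group G] [Group H]
    (hH : ResiduallySolvable H) (f : G →* H) (hf : Function.Injective f) :
    ResiduallySolvable G := by
  intro g hg
  obtain ⟨S, _, p, hS, hp⟩ := hH (f g) ((map_ne_one_iff f hf).2 hg)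
  exact ⟨S, _, p.comp f, hS, hp⟩

theorem ResiduallySolvable.of_derivedSeries {G : Type u} [Group G]
    (h : ∀ g : G, g ≠ 1 → ∃ n, g ∉ derivedSeries G n) : ResiduallySolvable G := by
  intro g hg
  obtain ⟨n, hn⟩ := h g hg
  refine ⟨G ⧸ derivedSeries G n, inferInstance, QuotientGroup.mk' _, ⟨n, ?_⟩, ?_⟩
  · rw [← map_derivedSeries_eq (QuotientGroup.mk'_surjective _), QuotientGroup.map_mk'_self]
  · rwa [QuotientGroup.mk'_apply, Ne, QuotientGroup.eq_one_iff]

end ResidualSolvability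

section FilteredRing

open scoped commutatorElement

variable {R : Type*} [Ring R]

/-- The units congruent to `1` modulo the `k`-th step of a multiplicative filtration. -/
def congruenceUnits (I : ℕ → AddSubgroup R)
    (hmul : ∀ a b x y, x ∈ I a → y ∈ I b → x * y ∈ I (a + b)) (hanti : Antitone I) (k : ℕ) :
    Subgroup Rˣ where
  carrier := {u | (u : R) - 1 ∈ I k ∧ ((u⁻¹ : Rˣ) : R) - 1 ∈ I k}
  one_mem' := by simp
  inv_mem' := by
    rintro u ⟨h, h'⟩
    exact ⟨h', by simpa using h⟩
  mul_mem' := by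
    have key : ∀ x y : R, x - 1 ∈ I k → y - 1 ∈ I k → x * y - 1 ∈ I k := by
      intro x y hx hy
      have e : x * y - 1 = (x - 1) * (y - 1) + (x - 1) + (y - 1) := by noncomm_ring
      rw [e]
      exact add_mem (add_mem (hanti (Nat.le_add_right k k) (hmul _ _ _ _ hx hy)) hx) hy
    rintro u v ⟨hu, hu'⟩ ⟨hv, hv'⟩
    refine ⟨by simpa using key _ _ hu hv, ?_⟩
    rw [mul_inv_rev]
    simpa using key _ _ hv' hu'

theorem commutatorElement_mem_congruenceUnits {I : ℕ → AddSubgroup R}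
    (hone : (1 : R) ∈ I 0) (hmul : ∀ a b x y, x ∈ I a → y ∈ I b → x * y ∈ I (a + b))
    (hanti : Antitone I) {a b : ℕ} {u v : Rˣ} (hu : u ∈ congruenceUnits I hmul hanti a)
    (hv : v ∈ congruenceUnits I hmul hanti b) :
    ⁅u, v⁆ ∈ congruenceUnits I hmul hanti (a + b) := by
  have key : ∀ {a b : ℕ} {u v : Rˣ}, u ∈ congruenceUnits I hmul hanti a →
      v ∈ congruenceUnits I hmul hanti b → ((⁅u, v⁆ : Rˣ) : R) - 1 ∈ I (a + b) := by
    intro a b u v hu hv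
    have inv_mem : ∀ {c : ℕ} {w : Rˣ}, w ∈ congruenceUnits I hmul hanti c →
        ((w⁻¹ : Rˣ) : R) ∈ I 0 := by
      intro c w hw
      simpa using add_mem (hanti (Nat.zero_le c) hw.2) hone
    have e : ((⁅u, v⁆ : Rˣ) : R) - 1 =
        (((u : R) - 1) * (v - 1) - (v - 1) * (u - 1)) *
          (((u⁻¹ : Rˣ) : R) * ((v⁻¹ : Rˣ) : R)) := by
      have e₁ : ((u : R) - 1) * (v - 1) - (v - 1) * (u - 1) = u * v - v * u := by noncomm_ring
      have e₂ : (v : R) * u * (((u⁻¹ : Rˣ) : R) * ((v⁻¹ : Rˣ) : R)) = 1 := by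
        simp [mul_assoc]
      rw [e₁, sub_mul, e₂, commutatorElement_def]
      simp [mul_assoc]
    rw [e]
    exact hmul (a + b) 0 _ _
      (sub_mem (hmul _ _ _ _ hu.1 hv.1) (add_comm b a ▸ hmul _ _ _ _ hv.1 hu.1))
      (hmul 0 0 _ _ (inv_mem hu) (inv_mem hv))
  refine ⟨key hu hv, ?_⟩
  rw [commutatorElement_inv, add_comm]
  exact key hv hu

theorem map_derivedSeries_mem_congruenceUnits {G : Type*} [Group G] {I : ℕ → AddSubgroup R}
    (hone : (1 : R) ∈ I 0) (hmul : ∀ a b x y, x ∈ I a → y ∈ I b → x * y ∈ I (a + b))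
    (hanti : Antitone I) (f : G →* Rˣ) (hf : ∀ g, f g ∈ congruenceUnits I hmul hanti 1) (k : ℕ) :
    derivedSeries G k ≤ (congruenceUnits I hmul hanti (k + 1)).comap f := by
  induction k with
  | zero => exact fun g _ => hf g
  | succ k ih =>
    rw [derivedSeries_succ, Subgroup.commutator_le]
    intro g hg h hh
    have := commutatorElement_mem_congruenceUnits hone hmul hanti (ih hg) (hf h)
    rw [Subgroup.mem_comap, map_commutatorElement]
    exact this

end FilteredRing

section FreeGroup

/-- The integer sequences supported on `{0, …, m - 1}`. -/
def supportedBelow (m : ℕ) : AddSubgroup (ℕ → ℤ) where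
  carrier := {v | ∀ a, m ≤ a → v a = 0}
  zero_mem' := fun _ _ => rfl
  add_mem' := fun hv hw a ha => by simp [hv a ha, hw a ha]
  neg_mem' := fun hv a ha => by simp [hv a ha]

/-- The endomorphisms lowering the support of every finitely supported sequence by `k`. -/
def loweringFiltration (k : ℕ) : AddSubgroup (Module.End ℤ (ℕ → ℤ)) where
  carrier := {T | ∀ m, ∀ v ∈ supportedBelow m, T v ∈ supportedBelow (m - k)}
  zero_mem' := fun _ _ _ => zero_mem _
  add_mem' := fun hS hT m v hv => add_mem (hS m v hv) (hT m v hv)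
  neg_mem' := fun hT m v hv => neg_mem (hT m v hv)

theorem one_mem_loweringFiltration : 1 ∈ loweringFiltration 0 := fun _ _ hv => hv

theorem mul_mem_loweringFiltration (a b : ℕ) (S T : Module.End ℤ (ℕ → ℤ))
    (hS : S ∈ loweringFiltration a) (hT : T ∈ loweringFiltration b) :
    S * T ∈ loweringFiltration (a + b) := by
  intro m v hv
  have := hS _ _ (hT m v hv)
  rwa [Nat.sub_sub, add_comm b a] at this

theorem loweringFiltration_antitone : Antitone loweringFiltration :=
  fun _ _ hab _ hT m v hv c hc => hT m v hv c (by omega)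

/-- The left shift, restricted to the positions in `s`. -/
noncomputable def restrictedShift (s : Set ℕ) : Module.End ℤ (ℕ → ℤ) := by
  classical
  exact
    { toFun := fun v a => if a ∈ s then v (a + 1) else 0
      map_add' := fun v w => by ext a; by_cases h : a ∈ s <;> simp [h]
      map_smul' := fun n v => by ext a; by_cases h : a ∈ s <;> simp [h] }

theorem restrictedShift_apply_of_mem {s : Set ℕ} {a : ℕ} (h : a ∈ s) (v : ℕ → ℤ) :
    restrictedShift s v a = v (a + 1) := if_pos h

theorem restrictedShift_apply_of_notMem {s : Set ℕ} {a : ℕ} (h : a ∉ s) (v : ℕ → ℤ) :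
    restrictedShift s v a = 0 := if_neg h

theorem restrictedShift_apply_eq_zero {s : Set ℕ} {a : ℕ} {v : ℕ → ℤ} (h : v (a + 1) = 0) :
    restrictedShift s v a = 0 := by
  by_cases ha : a ∈ s
  · rw [restrictedShift_apply_of_mem ha, h]
  · exact restrictedShift_apply_of_notMem ha v

theorem restrictedShift_mem_loweringFiltration (s : Set ℕ) :
    restrictedShift s ∈ loweringFiltration 1 :=
  fun _ _ hv a ha => restrictedShift_apply_eq_zero (hv (a + 1) (by omega))

theorem restrictedShift_mul_self {s : Set ℕ} (hs : ∀ a ∈ s, a + 1 ∉ s) :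
    restrictedShift s * restrictedShift s = 0 := by
  refine LinearMap.ext fun v => funext fun a => ?_
  by_cases ha : a ∈ s
  · exact restrictedShift_apply_eq_zero (restrictedShift_apply_of_notMem (hs a ha) v)
  · exact restrictedShift_apply_of_notMem ha _

/-- The unit `1 + T` of a ring, for `T` of square zero. -/
def oneAddUnit {R : Type*} [Ring R] (T : R) (hT : T * T = 0) : Rˣ where
  val := 1 + T
  inv := 1 - T
  val_inv := by
    have e : (1 + T) * (1 - T) = 1 - T * T := by noncomm_ring
    rw [e, hT, sub_zero]
  inv_val := by
    have e : (1 - T) * (1 + T) = 1 - T * T := by noncomm_ring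
    rw [e, hT, sub_zero]

theorem oneAddUnit_zpow {R : Type*} [Ring R] (T : R) (hT : T * T = 0) (n : ℤ) :
    ((oneAddUnit T hT ^ n : Rˣ) : R) = 1 + n • T := by
  induction n with
  | zero => simp
  | succ n ih =>
    rw [zpow_add_one, Units.val_mul, ih]
    change (1 + (n : ℤ) • T) * (1 + T) = _
    rw [add_mul, one_mul, mul_add, mul_one, smul_mul_assoc, hT, add_smul, one_smul, smul_zero]
    abel
  | pred n ih =>
    rw [zpow_sub_one, Units.val_mul, ih]
    change (1 + (-(n : ℤ)) • T) * (1 - T) = _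
    rw [add_mul, one_mul, mul_sub, mul_one, smul_mul_assoc, hT, sub_smul, one_smul, smul_zero]
    abel

/-- The product of the syllables `x ^ n` of a list of pairs `(x, n)`. -/
def syllableProd {α : Type*} (l : List (α × ℤ)) : FreeGroup α :=
  (l.map fun p => FreeGroup.of p.1 ^ p.2).prod

/-- A list of syllables is reduced if its exponents are nonzero and adjacent generators differ. -/
def IsSyllableReduced {α : Type*} (l : List (α × ℤ)) : Prop :=
  (∀ p ∈ l, p.2 ≠ 0) ∧ l.IsChain fun p q => p.1 ≠ q.1

theorem IsSyllableReduced.exists_zpow_mul {α : Type*} {l : List (α × ℤ)}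
    (hl : IsSyllableReduced l) (x : α) (n : ℤ) :
    ∃ l' : List (α × ℤ), IsSyllableReduced l' ∧
      syllableProd l' = FreeGroup.of x ^ n * syllableProd l := by
  by_cases hn : n = 0
  · exact ⟨l, hl, by simp [hn]⟩
  match l, hl with
  | [], _ => exact ⟨[(x, n)], ⟨by simpa using hn, by simp⟩, by simp [syllableProd]⟩
  | (y, m) :: l, ⟨h0, hc⟩ =>
    by_cases hxy : x = y
    · subst hxy
      by_cases hnm : n + m = 0
      · refine ⟨l, ⟨fun p hp => h0 p (List.mem_cons_of_mem _ hp), hc.tail⟩, ?_⟩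
        simp [syllableProd, ← mul_assoc, ← zpow_add, hnm]
      · refine ⟨(x, n + m) :: l, ⟨?_, ?_⟩, by simp [syllableProd, zpow_add, mul_assoc]⟩
        · rintro p (_ | ⟨_, hp⟩)
          · exact hnm
          · exact h0 p (List.mem_cons_of_mem _ hp)
        · rw [List.isChain_cons] at hc ⊢
          exact hc
    · refine ⟨(x, n) :: (y, m) :: l, ⟨?_, ?_⟩, by simp [syllableProd]⟩
      · rintro p (_ | ⟨_, hp⟩)
        · exact hn
        · exact h0 p hp
      · exact List.isChain_cons_cons.2 ⟨hxy, hc⟩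

theorem exists_syllableProd_eq {α : Type*} (w : FreeGroup α) :
    ∃ l : List (α × ℤ), IsSyllableReduced l ∧ syllableProd l = w := by
  obtain ⟨L, rfl⟩ := Quot.exists_rep w
  change ∃ l, _ ∧ _ = FreeGroup.mk L
  induction L with
  | nil => exact ⟨[], ⟨by simp, by simp⟩, rfl⟩
  | cons p L ih =>
    obtain ⟨l, hl, h⟩ := ih
    obtain ⟨x, b⟩ := p
    have e : FreeGroup.mk ((x, b) :: L) = FreeGroup.mk [(x, b)] * FreeGroup.mk L := by
      simp [FreeGroup.mul_mk]
    rw [e, ← h]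
    cases b with
    | true => simpa [FreeGroup.of] using hl.exists_zpow_mul x 1
    | false => simpa [FreeGroup.of, FreeGroup.inv_mk, FreeGroup.invRev] using
        hl.exists_zpow_mul x (-1)

/-- The positions at which the generator `x` occurs in a list of syllables. -/
def syllablePositions {α : Type*} (l : List (α × ℤ)) (x : α) : Set ℕ :=
  {a | ∃ n, l[a]? = some (x, n)}

theorem IsSyllableReduced.succ_notMem_syllablePositions {α : Type*} {l : List (α × ℤ)}
    (hl : IsSyllableReduced l) (x : α) :
    ∀ a ∈ syllablePositions l x, a + 1 ∉ syllablePositions l x := by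
  rintro a ⟨n, hn⟩ ⟨m, hm⟩
  obtain ⟨h, hm⟩ := List.getElem?_eq_some_iff.1 hm
  obtain ⟨h', hn⟩ := List.getElem?_eq_some_iff.1 hn
  have := List.isChain_iff_getElem.1 hl.2 a h
  rw [hm, hn] at this
  exact this rfl

/-- The unipotent representation of a free group adapted to a reduced list of syllables. -/
noncomputable def syllableRep {α : Type*} {l : List (α × ℤ)} (hl : IsSyllableReduced l) :
    FreeGroup α →* (Module.End ℤ (ℕ → ℤ))ˣ :=
  FreeGroup.lift fun x => oneAddUnit (restrictedShift (syllablePositions l x))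
    (restrictedShift_mul_self (hl.succ_notMem_syllablePositions x))

theorem syllableRep_of {α : Type*} {l : List (α × ℤ)} (hl : IsSyllableReduced l) (x : α) :
    syllableRep hl (FreeGroup.of x) = oneAddUnit (restrictedShift (syllablePositions l x))
      (restrictedShift_mul_self (hl.succ_notMem_syllablePositions x)) :=
  FreeGroup.lift_apply_of

theorem syllableRep_mem_congruenceUnits {α : Type*} {l : List (α × ℤ)}
    (hl : IsSyllableReduced l) (w : FreeGroup α) :
    syllableRep hl w ∈ congruenceUnits loweringFiltration mul_mem_loweringFiltration
      loweringFiltration_antitone 1 := by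
  have of_mem : ∀ x, syllableRep hl (FreeGroup.of x) ∈ congruenceUnits loweringFiltration
      mul_mem_loweringFiltration loweringFiltration_antitone 1 := by
    intro x
    rw [syllableRep_of]
    constructor
    · change 1 + restrictedShift _ - 1 ∈ _
      rw [add_sub_cancel_left]
      exact restrictedShift_mem_loweringFiltration _
    · change 1 - restrictedShift _ - 1 ∈ _
      rw [sub_sub_cancel_left]
      exact neg_mem (restrictedShift_mem_loweringFiltration _)
  induction w using FreeGroup.induction_on with
  | C1 => rw [map_one]; exact one_mem _
  | of x => exact of_mem x
  | inv_of x _ => rw [map_inv]; exact inv_mem (of_mem x)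
  | mul x y hx hy => rw [map_mul]; exact mul_mem hx hy

theorem syllableRep_suffix_apply {α : Type*} {l : List (α × ℤ)} (hl : IsSyllableReduced l)
    (p q : List (α × ℤ)) (h : p ++ q = l) :
    (∀ a < p.length, (syllableRep hl (syllableProd q)).val (Pi.single l.length 1) a = 0) ∧
      (syllableRep hl (syllableProd q)).val (Pi.single l.length 1) p.length ≠ 0 := by
  induction q generalizing p with
  | nil =>
    subst h
    constructor
    · intro a ha
      simp [syllableProd, ha.ne]
    · simp [syllableProd]
  | cons s q ih =>
    obtain ⟨x, n⟩ := s
    obtain ⟨h0, h1⟩ := ih (p ++ [(x, n)]) (by simpa using h)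
    rw [List.length_append, List.length_singleton] at h0 h1
    have e : syllableProd ((x, n) :: q) = FreeGroup.of x ^ n * syllableProd q := by
      simp [syllableProd]
    rw [e, map_mul, map_zpow, syllableRep_of, Units.val_mul, oneAddUnit_zpow]
    set v := (syllableRep hl (syllableProd q)).val (Pi.single l.length 1) with hv
    have apply_eq : ∀ a, ((1 + n • restrictedShift (syllablePositions l x)) *
        (syllableRep hl (syllableProd q)).val) (Pi.single l.length 1) a =
        v a + n * restrictedShift (syllablePositions l x) v a := by
      intro a
      simp [hv]
    constructor
    · intro a ha
      rw [apply_eq, h0 a (by omega), restrictedShift_apply_eq_zero (h0 _ (by omega))]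
      simp
    · have hp : p.length ∈ syllablePositions l x := ⟨n, by simp [← h]⟩
      rw [apply_eq, h0 _ (by omega), restrictedShift_apply_of_mem hp, zero_add]
      exact mul_ne_zero (hl.1 (x, n) (by simp [← h])) h1

theorem FreeGroup.residuallySolvable (α : Type u) : ResiduallySolvable (FreeGroup α) := by
  refine ResiduallySolvable.of_derivedSeries fun w hw => ?_
  obtain ⟨l, hl, rfl⟩ := exists_syllableProd_eq w
  refine ⟨l.length, fun hmem => ?_⟩
  have hpos : l.length ≠ 0 := by
    rintro h
    rw [List.length_eq_zero_iff] at h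
    subst h
    exact hw rfl
  have h := (map_derivedSeries_mem_congruenceUnits one_mem_loweringFiltration
    mul_mem_loweringFiltration loweringFiltration_antitone (syllableRep hl)
    (syllableRep_mem_congruenceUnits hl) l.length hmem).1 (l.length + 1)
    (Pi.single l.length 1) (fun a ha => Pi.single_eq_of_ne (by omega) _) 0 (by omega)
  refine (syllableRep_suffix_apply hl [] l rfl).2 ?_
  simpa [sub_eq_zero, hpos.symm, Pi.single_apply] using h

end FreeGroup

namespace Double

variable {A : Type u} [Group A] (C : Subgroup A) (φ : A ≃* A)

theorem inl_eq_inr (c : C) : inl C φ c = inr C φ (φ c) :=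
  (Monoid.PushoutI.of_apply_eq_base (doubleMaps C φ) false c).trans
    (Monoid.PushoutI.of_apply_eq_base (doubleMaps C φ) true c).symm

/-- The cosets of the amalgamated subgroup, as a subgroup of the second copy of `A`. -/
abbrev Cosets : Type u := A ⧸ C.map (φ : A →* A)

/-- The action of `A` on the free group on the cosets of the amalgamated subgroup. -/
def cosetAction : A →* MulAut (FreeGroup (Cosets C φ)) where
  toFun a := FreeGroup.freeGroupCongr (MulAction.toPerm a)
  map_one' := MulEquiv.toMonoidHom_injective (FreeGroup.ext_hom _ _ fun x => by simp)
  map_mul' a b := MulEquiv.toMonoidHom_injective (FreeGroup.ext_hom _ _ fun x => by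
    simp [mul_smul])

@[simp]
theorem cosetAction_of (a : A) (x : Cosets C φ) :
    cosetAction C φ a (FreeGroup.of x) = FreeGroup.of (a • x) := by
  simp [cosetAction]

/-- The double maps to the semidirect product `FreeGroup (A ⧸ φ(C)) ⋊ A`: the first copy of `A`
goes to the complement `A` via `φ`, the second copy to the conjugate of `A` by the generator
corresponding to the trivial coset. -/
def toSemidirect : Double C φ →* FreeGroup (Cosets C φ) ⋊[cosetAction C φ] A :=
  Monoid.PushoutI.lift
    (fun b => match b with
      | false => SemidirectProduct.inr.comp (φ : A →* A)
      | true => (MulAut.conj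
          (SemidirectProduct.inl (FreeGroup.of ((1 : A) : Cosets C φ)))).toMonoidHom.comp
            SemidirectProduct.inr)
    ((SemidirectProduct.inr.comp (φ : A →* A)).comp C.subtype)
    (by
      rintro (_ | _)
      · rfl
      · ext1 c
        have hc : φ c • ((1 : A) : Cosets C φ) = ((1 : A) : Cosets C φ) := by
          rw [MulAction.Quotient.smul_coe, QuotientGroup.eq]
          simp
        ext <;> simp [doubleMaps, hc])

theorem toSemidirect_inl (a : A) :
    toSemidirect C φ (inl C φ a) = SemidirectProduct.inr (φ a) :=
  Monoid.PushoutI.lift_of ..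

theorem toSemidirect_inr (a : A) :
    toSemidirect C φ (inr C φ a) =
      ⟨FreeGroup.of ((1 : A) : Cosets C φ) * (FreeGroup.of (a : Cosets C φ))⁻¹, a⟩ := by
  refine (Monoid.PushoutI.lift_of ..).trans ?_
  ext <;> simp

/-- The map from the free group on cosets back to the double, sending the generator `a φ(C)` to
the quotient of the two embeddings of `a`. -/
def ofFreeGroup : FreeGroup (Cosets C φ) →* Double C φ :=
  FreeGroup.lift fun x => Quotient.liftOn' x
    (fun a => inl C φ (φ.symm a) * (inr C φ a)⁻¹) (by
      intro a b hab
      obtain ⟨c, hc, h⟩ := QuotientGroup.leftRel_apply.1 hab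
      obtain rfl : b = a * φ c := by
        rw [← mul_inv_cancel_left a b, ← h]; rfl
      have := inl_eq_inr C φ ⟨c, hc⟩
      simp only at this
      simp [this])

theorem ofFreeGroup_of (a : A) :
    ofFreeGroup C φ (FreeGroup.of (a : Cosets C φ)) =
      inl C φ (φ.symm a) * (inr C φ a)⁻¹ :=
  FreeGroup.lift_apply_of

/-- The elements of the free group on cosets at which `ofFreeGroup` intertwines the action of `A`
with conjugation by the first copy of `A`. -/
def equivariantLocus : Subgroup (FreeGroup (Cosets C φ)) where
  carrier := {w | ∀ b, ofFreeGroup C φ (cosetAction C φ b w) =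
    MulAut.conj (inl C φ (φ.symm b)) (ofFreeGroup C φ w)}
  one_mem' b := by simp
  mul_mem' hv hw b := by simp only [map_mul, hv b, hw b]
  inv_mem' hv b := by simp only [map_inv, hv b]

theorem cosetAction_mem_equivariantLocus {w : FreeGroup (Cosets C φ)}
    (hw : w ∈ equivariantLocus C φ) (a : A) :
    cosetAction C φ a w ∈ equivariantLocus C φ := by
  intro b
  rw [hw a, ← MulAut.mul_apply, ← map_mul, hw (b * a), ← MulAut.mul_apply]
  simp only [map_mul]

theorem of_one_mul_of_inv_mem_equivariantLocus (a : A) :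
    FreeGroup.of ((1 : A) : Cosets C φ) * (FreeGroup.of (a : Cosets C φ))⁻¹ ∈
      equivariantLocus C φ := by
  intro b
  simp [ofFreeGroup_of, mul_assoc]

theorem toSemidirect_spec (g : Double C φ) :
    (toSemidirect C φ g).left ∈ equivariantLocus C φ ∧
      g = ofFreeGroup C φ (toSemidirect C φ g).left *
        inl C φ (φ.symm (toSemidirect C φ g).right) := by
  have hinl : ∀ a, (toSemidirect C φ (inl C φ a)).left ∈ equivariantLocus C φ ∧
      inl C φ a = ofFreeGroup C φ (toSemidirect C φ (inl C φ a)).left *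
        inl C φ (φ.symm (toSemidirect C φ (inl C φ a)).right) := by
    intro a
    rw [toSemidirect_inl]
    exact ⟨one_mem _, by simp⟩
  have hinr : ∀ a, (toSemidirect C φ (inr C φ a)).left ∈ equivariantLocus C φ ∧
      inr C φ a = ofFreeGroup C φ (toSemidirect C φ (inr C φ a)).left *
        inl C φ (φ.symm (toSemidirect C φ (inr C φ a)).right) := by
    intro a
    rw [toSemidirect_inr]
    exact ⟨of_one_mul_of_inv_mem_equivariantLocus C φ a, by simp [ofFreeGroup_of]⟩
  induction g using Monoid.PushoutI.induction_on with
  | of i a =>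
    cases i
    · exact hinl a
    · exact hinr a
  | base c =>
    rw [← Monoid.PushoutI.of_apply_eq_base (doubleMaps C φ) false c]
    exact hinl c
  | mul g h hg hh =>
    rw [map_mul, SemidirectProduct.mul_left, SemidirectProduct.mul_right]
    refine ⟨mul_mem hg.1 (cosetAction_mem_equivariantLocus C φ hh.1 _), ?_⟩
    rw [map_mul, hh.1, map_mul, map_mul]
    nth_rewrite 1 [hg.2, hh.2]
    simp [mul_assoc]

/-- The folding map from the double onto `A`. -/
def fold : Double C φ →* A := SemidirectProduct.rightHom.comp (toSemidirect C φ)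

/-- The kernel of the folding map embeds into a free group. -/
def foldKerToFreeGroup : (fold C φ).ker →* FreeGroup (Cosets C φ) where
  toFun g := (toSemidirect C φ g).left
  map_one' := by simp
  map_mul' g h := by
    have hg : (toSemidirect C φ g).right = 1 := g.2
    simp [hg]

theorem foldKerToFreeGroup_injective : Function.Injective (foldKerToFreeGroup C φ) := by
  rw [injective_iff_map_eq_one]
  intro g h
  have hl : (toSemidirect C φ g).left = 1 := h
  have hr : (toSemidirect C φ g).right = 1 := g.2
  have := (toSemidirect_spec C φ g).2
  rw [hl, hr] at this
  exact Subtype.ext (by simpa using this)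

end Double

/-- **Corollary (meta).** If `A` is residually solvable, then the double
`G = A ∗_{C = φ(C)} A` is meta-residually-solvable: it has a normal subgroup `N` such that
both `N` and `G/N` are residually solvable. -/
theorem double_meta_residually_solvable {A : Type u} [Group A]
    (hA : ResiduallySolvable A) (C : Subgroup A) (φ : A ≃* A) :
    ∃ N : Subgroup (Double C φ), ∃ _ : N.Normal,
      ResiduallySolvable N ∧ ResiduallySolvable (Double C φ ⧸ N) :=
  ⟨(Double.fold C φ).ker, inferInstance,
    (FreeGroup.residuallySolvable _).of_injective _ (Double.foldKerToFreeGroup_injective C φ),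
    hA.of_injective _ (QuotientGroup.kerLift_injective (Double.fold C φ))⟩
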